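/- arXiv:2107.03197 — 3 statements merged into one kernel-verified Lean document; each statement's English description precedes it below -/
import Mathlib

section
/- For any rationals p, q, r with p, q nonzero, the triple (a,b,c) with a=(p²+r²)/p, b=(q²+r²)/q, c=(r²-pq)(p+q)/(pq) satisfies the polynomial identity 16·(rc)² = 2a²b²+2b²c²+2c²a² - a⁴ - b⁴ - c⁴, i.e. the area given by Heron's formula equals |rc|. -/
/-- For any rationals p, q, r with p, q nonzero, Brahmagupta's triple satisfies
the Heron identity 16 (rc)² = 2a²b² + 2b²c² + 2c²a² − a⁴ − b⁴ − c⁴. -/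
theorem brahmagupta_heron_identity (p q r : ℚ) (hp : p ≠ 0) (hq : q ≠ 0) :
    let a := (p ^ 2 + r ^ 2) / p
    let b := (q ^ 2 + r ^ 2) / q
    let c := (r ^ 2 - p * q) * (p + q) / (p * q)
    16 * (r * c) ^ 2 =
      2 * a ^ 2 * b ^ 2 + 2 * b ^ 2 * c ^ 2 + 2 * c ^ 2 * a ^ 2
        - a ^ 4 - b ^ 4 - c ^ 4 := by
  intro a b c
  simp only [a, b, c]
  field_simp
  ring
end

section
/- Suppose a sequence of nonzero rationals (τₙ) satisfies τₙ₊₅τₙ = τₙ₊₄τₙ₊₁ + τₙ₊₃τₙ₊₂ for all n, and suppose τ₁,...,τ₅ are pairwise coprime integers. Then any five consecutive terms τₙ,...,τₙ₊₄ (if they are integers) are pairwise coprime: gcd(τᵢ,τⱼ)=1 for |i-j|<5. -/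
/-- The tropical constraints on the `p`-adic valuations of a Somos-5 sequence. -/
structure IsSomosVal (v : ℤ → ℤ) : Prop where
  le : ∀ n, v (n + 4) + v (n + 1) ≤ v (n + 5) + v n ∨ v (n + 3) + v (n + 2) ≤ v (n + 5) + v n
  eq_outer : ∀ n, v (n + 4) + v (n + 1) < v (n + 3) + v (n + 2) →
    v (n + 5) + v n = v (n + 4) + v (n + 1)
  eq_inner : ∀ n, v (n + 3) + v (n + 2) < v (n + 4) + v (n + 1) →
    v (n + 5) + v n = v (n + 3) + v (n + 2)

/-- The valuation of the ratio `τ n * τ (n + 3) / (τ (n + 1) * τ (n + 2))`. -/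
def ratioVal (v : ℤ → ℤ) (n : ℤ) : ℤ := v n + v (n + 3) - v (n + 1) - v (n + 2)

/-- The constraints on valuations when the Somos-5 invariant is `p`-integral. -/
structure InvIntegral (v : ℤ → ℤ) : Prop where
  fwd : ∀ n, 0 ≤ ratioVal v n → ratioVal v (n + 1) = 0 → 0 ≤ ratioVal v (n + 2)
  bwd : ∀ n, 0 ≤ ratioVal v (n + 2) → ratioVal v (n + 1) = 0 → 0 ≤ ratioVal v n

/-- The constraints on valuations when the Somos-5 invariant has valuation `-r < 0`. -/
structure InvPole (v : ℤ → ℤ) (r : ℤ) : Prop where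
  pos : 0 < r
  fwd : ∀ n, -r < ratioVal v n → ratioVal v (n + 1) = 0 → ratioVal v (n + 2) = -r
  bwd : ∀ n, -r < ratioVal v (n + 2) → ratioVal v (n + 1) = 0 → ratioVal v n = -r

theorem IsSomosVal.shift {v : ℤ → ℤ} (h : IsSomosVal v) (c : ℤ) :
    IsSomosVal fun k => v (c + k) := by
  constructor <;> intro n <;> simp only [← add_assoc]
  exacts [h.le _, h.eq_outer _, h.eq_inner _]

theorem IsSomosVal.reflect {v : ℤ → ℤ} (h : IsSomosVal v) : IsSomosVal fun k => v (-k) := by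
  have e (n k l : ℤ) (hl : l = 5 - k) : -(n + k) = -(n + 5) + l := by omega
  have e0 (n : ℤ) : -n = -(n + 5) + 5 := by omega
  constructor <;> intro n <;>
    simp only [e n 4 1 (by norm_num), e n 1 4 (by norm_num), e n 3 2 (by norm_num),
      e n 2 3 (by norm_num), e0 n]
  · have := h.le (-(n + 5)); omega
  · have := h.eq_outer (-(n + 5)); omega
  · have := h.eq_inner (-(n + 5)); omega

theorem ratioVal_shift (v : ℤ → ℤ) (c n : ℤ) :
    ratioVal (fun k => v (c + k)) n = ratioVal v (c + n) := by
  simp only [ratioVal, ← add_assoc]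

theorem ratioVal_reflect (v : ℤ → ℤ) (n : ℤ) :
    ratioVal (fun k => v (-k)) n = ratioVal v (-n - 3) := by
  simp only [ratioVal, show -(n + 3) = -n - 3 by ring, show -(n + 1) = -n - 3 + 2 by ring,
    show -(n + 2) = -n - 3 + 1 by ring, show -n - 3 + 3 = -n by ring]
  ring

theorem InvPole.shift {v : ℤ → ℤ} {r : ℤ} (h : InvPole v r) (c : ℤ) :
    InvPole (fun k => v (c + k)) r := by
  refine ⟨h.pos, ?_, ?_⟩ <;> intro n <;> simp only [ratioVal_shift, ← add_assoc]
  exacts [h.fwd _, h.bwd _]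

theorem InvPole.reflect {v : ℤ → ℤ} {r : ℤ} (h : InvPole v r) :
    InvPole (fun k => v (-k)) r := by
  refine ⟨h.pos, ?_, ?_⟩ <;> intro n <;>
    simp only [ratioVal_reflect, show -n - 3 = -(n + 2) - 3 + 2 by ring,
      show -(n + 1) - 3 = -(n + 2) - 3 + 1 by ring]
  exacts [h.bwd _, h.fwd _]

theorem InvIntegral.reflect {v : ℤ → ℤ} (h : InvIntegral v) : InvIntegral (fun k => v (-k)) := by
  constructor <;> intro n <;>
    simp only [ratioVal_reflect, show -n - 3 = -(n + 2) - 3 + 2 by ring,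
      show -(n + 1) - 3 = -(n + 2) - 3 + 1 by ring]
  exacts [h.bwd _, h.fwd _]

/-- Five consecutive nonnegative valuations, at most one of which is positive. -/
def CoprimeWindow (v : ℤ → ℤ) (n : ℤ) : Prop :=
  ∃ k : ℤ, n ≤ k ∧ k ≤ n + 4 ∧ 0 ≤ v k ∧ ∀ i, n ≤ i → i ≤ n + 4 → i ≠ k → v i = 0

theorem CoprimeWindow.reflect {v : ℤ → ℤ} {n : ℤ} (h : CoprimeWindow v n) :
    CoprimeWindow (fun k => v (-k)) (-n - 4) := by
  obtain ⟨k, h1, h2, h3, h4⟩ := h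
  refine ⟨-k, by omega, by omega, by simpa using h3, fun i _ _ _ => ?_⟩
  exact h4 (-i) (by omega) (by omega) (by omega)

theorem CoprimeWindow.succ {v : ℤ → ℤ} (h : IsSomosVal v) (hI : InvIntegral v) {n : ℤ}
    (hw : CoprimeWindow v n) : CoprimeWindow v (n + 1) := by
  obtain ⟨k, h1, h2, h3, h4⟩ := hw
  have a0 := h4 n
  have a1 := h4 (n + 1)
  have a2 := h4 (n + 2)
  have a3 := h4 (n + 3)
  have a4 := h4 (n + 4)
  have b1 := h.le n
  have b2 := h.eq_outer n
  have b3 := h.eq_inner n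
  have b4 := hI.fwd n
  simp only [ratioVal, add_assoc, Int.reduceAdd] at b4
  obtain rfl | rfl | rfl | rfl | rfl :
      k = n ∨ k = n + 1 ∨ k = n + 2 ∨ k = n + 3 ∨ k = n + 4 := by omega
  · refine ⟨k + 5, by omega, by omega, by omega, fun i _ _ _ => h4 i ?_ ?_ ?_⟩ <;> omega
  all_goals
    by_cases hz : v (n + 5) = 0
    · refine ⟨_, ?_, ?_, h3, fun i _ _ _ => ?_⟩
      · omega
      · omega
      · rcases eq_or_ne i (n + 5) with rfl | hi
        · exact hz
        · exact h4 i (by omega) (by omega) (by assumption)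
    · refine ⟨n + 5, by omega, by omega, by omega, fun i _ _ _ => ?_⟩
      obtain rfl | rfl | rfl | rfl :
        i = n + 1 ∨ i = n + 2 ∨ i = n + 3 ∨ i = n + 4 := by omega
      all_goals omega

theorem CoprimeWindow.add_nat {v : ℤ → ℤ} (h : IsSomosVal v) (hI : InvIntegral v) {n : ℤ}
    (hw : CoprimeWindow v n) (k : ℕ) : CoprimeWindow v (n + k) := by
  induction k with
  | zero => simpa using hw
  | succ k ih =>
    have := ih.succ h hI
    push_cast
    rwa [← add_assoc]

theorem CoprimeWindow.all {v : ℤ → ℤ} (h : IsSomosVal v) (hI : InvIntegral v) {n : ℤ}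
    (hw : CoprimeWindow v n) (m : ℤ) : CoprimeWindow v m := by
  rcases le_total n m with hm | hm
  · obtain ⟨k, hk⟩ := Int.le.dest hm
    exact hk ▸ hw.add_nat h hI k
  · obtain ⟨k, hk⟩ := Int.le.dest hm
    have := (hw.reflect.add_nat h.reflect hI.reflect k).reflect
    simp only [neg_neg] at this
    convert this using 1
    omega

/-- A local maximum of the valuation at `c`, up to gauge transformation, with nonpositive
nonincreasing valuations at its neighbours. -/
structure IsPeak (v : ℤ → ℤ) (c : ℤ) : Prop where
  left₂ : v (c + -2) ≤ 0
  left₁ : v (c + -1) ≤ 0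
  anti : v (c + 1) ≤ v (c + -1)
  gauge : v (c + 2) - v (c + -2) = 2 * (v (c + 1) - v (c + -1))
  peak : v (c + -2) + (v (c + 1) - v (c + -1)) < v (c + 0)

theorem IsPeak.next {v : ℤ → ℤ} {r : ℤ} (h : IsSomosVal v) (hJ : InvPole v r) {c : ℤ}
    (hc : IsPeak v c) : v (c + 3) ≤ 0 ∧ v (c + 4) ≤ 0 ∧ IsPeak v (c + 7) := by
  obtain ⟨h1, h2, h3, h4, h5⟩ := hc
  replace h := h.shift c
  replace hJ := hJ.shift c
  suffices H : v (c + 3) ≤ 0 ∧ v (c + 4) ≤ 0 ∧ v (c + 5) ≤ 0 ∧ v (c + 6) ≤ 0 ∧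
      v (c + 8) ≤ v (c + 6) ∧ v (c + 9) - v (c + 5) = 2 * (v (c + 8) - v (c + 6)) ∧
      v (c + 5) + (v (c + 8) - v (c + 6)) < v (c + 7) by
    obtain ⟨g1, g2, g3, g4, g5, g6, g7⟩ := H
    refine ⟨g1, g2, ?_⟩
    constructor <;> simpa only [add_assoc, Int.reduceAdd, Int.reduceNeg]
  generalize hw : (fun k => v (c + k)) = w at h hJ
  have e (k : ℤ) : v (c + k) = w k := by rw [← hw]
  simp only [e] at *
  have r0 := hJ.pos
  have s0 := h.eq_outer (-2)
  have s1 := h.eq_inner (-1)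
  have s2 := hJ.fwd 0
  have s3 := h.eq_outer 1
  have s4 := h.le 2
  have s5 := h.eq_inner 3
  have s6 := h.eq_outer 4
  simp only [ratioVal, Int.reduceAdd, Int.reduceNeg] at s0 s1 s2 s3 s4 s5 s6
  have t0 := s0 (by omega)
  have t1 := s1 (by omega)
  have t2 := s2 (by omega) (by omega)
  have t3 := s3 (by omega)
  have t5 := s5 (by omega)
  have t6 := s6 (by omega)
  omega

theorem IsPeak.add_nat {v : ℤ → ℤ} {r : ℤ} (h : IsSomosVal v) (hJ : InvPole v r) {c : ℤ}
    (hc : IsPeak v c) (k : ℕ) : IsPeak v (c + 7 * k) := by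
  induction k with
  | zero => simpa using hc
  | succ k ih =>
    have := (ih.next h hJ).2.2
    push_cast
    rwa [mul_add, mul_one, ← add_assoc]

theorem IsPeak.nonpos_of_le {v : ℤ → ℤ} {r : ℤ} (h : IsSomosVal v) (hJ : InvPole v r) {c : ℤ}
    (hc : IsPeak v c) {n : ℤ} (hn : c ≤ n) (hm : ¬ 7 ∣ n - c) : v n ≤ 0 := by
  obtain ⟨k, hk⟩ := Int.eq_ofNat_of_zero_le (show 0 ≤ (n - c) / 7 by omega)
  have hp := hc.add_nat h hJ k
  obtain ⟨h3, h4, hq⟩ := hp.next h hJ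
  have q1 := hq.left₂
  have q2 := hq.left₁
  obtain ⟨p1, p2, p3, p4, p5⟩ := hp
  have : n = c + 7 * k + 1 ∨ n = c + 7 * k + 2 ∨ n = c + 7 * k + 3 ∨ n = c + 7 * k + 4 ∨
      n = c + 7 * k + 7 + -2 ∨ n = c + 7 * k + 7 + -1 := by omega
  rcases this with rfl | rfl | rfl | rfl | rfl | rfl <;> omega

theorem CoprimeWindow.exists_nonpos {v : ℤ → ℤ} {r : ℤ} (h : IsSomosVal v) (hJ : InvPole v r)
    (hw : CoprimeWindow v 1) : ∃ c, ∀ n, ¬ 7 ∣ n - c → v n ≤ 0 := by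
  obtain ⟨c, h1, h2, h3, h4⟩ := hw
  have a1 := h4 1
  have a2 := h4 2
  have a3 := h4 3
  have a4 := h4 4
  have a5 := h4 5
  have r0 := hJ.pos
  have key : v (c + -2) = 0 ∧ v (c + -1) = 0 ∧ 0 < v c ∧ v (c + 1) = 0 ∧ v (c + 2) = 0 := by
    have s0 := h.eq_outer (-1)
    have s0' := h.eq_inner (-1)
    have s1 := h.eq_outer 0
    have s1' := h.eq_inner 0
    have s2 := h.eq_outer 1
    have s2' := h.eq_inner 1
    have s3 := h.eq_outer 2
    have s3' := h.eq_inner 2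
    have l1 := h.le 1
    have j := hJ.fwd 1
    simp only [ratioVal, Int.reduceAdd, Int.reduceNeg] at s0 s0' s1 s1' s2 s2' s3 s3' l1 j
    obtain rfl | rfl | rfl | rfl | rfl : c = 1 ∨ c = 2 ∨ c = 3 ∨ c = 4 ∨ c = 5 := by omega
    all_goals
      simp only [Int.reduceAdd, Int.reduceNeg]
      norm_num at a1 a2 a3 a4 a5
      omega
  obtain ⟨k1, k2, k3, k4, k5⟩ := key
  have hp : IsPeak v c := by
    rw [← add_zero c] at k3
    constructor <;> omega
  have hp' : IsPeak (fun k => v (-k)) (-c) := by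
    constructor <;> simp only [add_zero, neg_add, neg_neg] <;> omega
  refine ⟨c, fun n hn => ?_⟩
  rcases le_total c n with hc | hc
  · exact hp.nonpos_of_le h hJ hc hn
  · simpa using hp'.nonpos_of_le h.reflect hJ.reflect (n := -n) (by omega) (by omega)

section Valuation

variable {p : ℕ} [hp : Fact p.Prime]

theorem padicValRat_add_ge {m : ℤ} {x y : ℚ} (hx : x = 0 ∨ m ≤ padicValRat p x)
    (hy : y = 0 ∨ m ≤ padicValRat p y) : x + y = 0 ∨ m ≤ padicValRat p (x + y) := by
  rcases hx with rfl | hx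
  · simpa using hy
  rcases hy with rfl | hy
  · simpa using Or.inr hx
  by_cases h : x + y = 0
  · exact Or.inl h
  · exact Or.inr ((le_min hx hy).trans (padicValRat.min_le_padicValRat_add h))

theorem padicValRat_sub_ge {m : ℤ} {x y : ℚ} (hx : x = 0 ∨ m ≤ padicValRat p x)
    (hy : y = 0 ∨ m ≤ padicValRat p y) : x - y = 0 ∨ m ≤ padicValRat p (x - y) := by
  rw [sub_eq_add_neg]
  exact padicValRat_add_ge hx (by simpa using hy)

theorem padicValRat_sub_eq {x y : ℚ} (hx : x ≠ 0) (hxy : x - y ≠ 0)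
    (hy : y = 0 ∨ padicValRat p x + 1 ≤ padicValRat p y) :
    padicValRat p (x - y) = padicValRat p x := by
  rcases hy with rfl | hy
  · simp
  by_cases h0 : y = 0
  · simp [h0]
  rw [sub_eq_add_neg] at hxy ⊢
  exact padicValRat.add_eq_of_lt hxy hx (by simpa using h0) (by simpa using by omega)

theorem isSomosVal_padicValRat {τ : ℤ → ℚ} (hne : ∀ n, τ n ≠ 0)
    (hrec : ∀ n : ℤ, τ (n + 5) * τ n = τ (n + 4) * τ (n + 1) + τ (n + 3) * τ (n + 2)) :
    IsSomosVal fun n => padicValRat p (τ n) := by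
  have hm (i j : ℤ) : padicValRat p (τ i * τ j) = padicValRat p (τ i) + padicValRat p (τ j) :=
    padicValRat.mul (hne _) (hne _)
  have hz (i j : ℤ) : τ i * τ j ≠ 0 := mul_ne_zero (hne _) (hne _)
  have hs (n : ℤ) : τ (n + 4) * τ (n + 1) + τ (n + 3) * τ (n + 2) ≠ 0 := hrec n ▸ hz _ _
  constructor <;> intro n <;> simp only [← hm, hrec]
  · exact min_le_iff.1 (padicValRat.min_le_padicValRat_add (hs n))
  · exact fun h => padicValRat.add_eq_of_lt (hs n) (hz _ _) (hz _ _) h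
  · intro h
    have := hs n
    rw [add_comm] at this ⊢
    exact padicValRat.add_eq_of_lt this (hz _ _) (hz _ _) h

end Valuation

/-- The ratio of Somos-5 terms satisfying a second-order recurrence. -/
def somosRatio (τ : ℤ → ℚ) (n : ℤ) : ℚ := τ n * τ (n + 3) / (τ (n + 1) * τ (n + 2))

theorem somosRatio_ne_zero {τ : ℤ → ℚ} (hne : ∀ n, τ n ≠ 0) (n : ℤ) : somosRatio τ n ≠ 0 := by
  simp [somosRatio, hne]

theorem padicValRat_somosRatio {p : ℕ} [Fact p.Prime] {τ : ℤ → ℚ} (hne : ∀ n, τ n ≠ 0) (n : ℤ) :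
    padicValRat p (somosRatio τ n) = ratioVal (fun n => padicValRat p (τ n)) n := by
  rw [somosRatio, padicValRat.div (mul_ne_zero (hne _) (hne _)) (mul_ne_zero (hne _) (hne _)),
    padicValRat.mul (hne _) (hne _), padicValRat.mul (hne _) (hne _), ratioVal]
  ring

theorem somosRatio_rec {τ : ℤ → ℚ} (hne : ∀ n, τ n ≠ 0)
    (hrec : ∀ n : ℤ, τ (n + 5) * τ n = τ (n + 4) * τ (n + 1) + τ (n + 3) * τ (n + 2)) (n : ℤ) :
    somosRatio τ n * somosRatio τ (n + 1) * somosRatio τ (n + 2) = somosRatio τ (n + 1) + 1 := by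
  have h := hrec n
  have h0 := hne n
  have h1 := hne (n + 1)
  have h2 := hne (n + 2)
  have h3 := hne (n + 3)
  have h4 := hne (n + 4)
  simp only [somosRatio, add_assoc, Int.reduceAdd]
  field_simp
  linear_combination h

/-- The conserved quantity of the Somos-5 recurrence. -/
def somosInv (τ : ℤ → ℚ) (n : ℤ) : ℚ :=
  somosRatio τ n + somosRatio τ (n + 1) + somosRatio τ (n + 2) + (somosRatio τ (n + 1))⁻¹

theorem somosInv_succ {τ : ℤ → ℚ} (hne : ∀ n, τ n ≠ 0)
    (hrec : ∀ n : ℤ, τ (n + 5) * τ n = τ (n + 4) * τ (n + 1) + τ (n + 3) * τ (n + 2)) (n : ℤ) :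
    somosInv τ (n + 1) = somosInv τ n := by
  have e1 := somosRatio_rec hne hrec n
  have e2 := somosRatio_rec hne hrec (n + 1)
  have h1 := somosRatio_ne_zero hne (n + 1)
  have h2 := somosRatio_ne_zero hne (n + 2)
  simp only [somosInv, add_assoc, Int.reduceAdd] at *
  field_simp
  linear_combination e2 - e1

theorem somosInv_eq {τ : ℤ → ℚ} (hne : ∀ n, τ n ≠ 0)
    (hrec : ∀ n : ℤ, τ (n + 5) * τ n = τ (n + 4) * τ (n + 1) + τ (n + 3) * τ (n + 2)) (n : ℤ) :
    somosInv τ n = somosInv τ 0 := by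
  have hper : Function.Periodic (somosInv τ) 1 := somosInv_succ hne hrec
  simpa using hper.int_mul_eq n

theorem invIntegral_or_invPole (p : ℕ) [Fact p.Prime] {τ : ℤ → ℚ} (hne : ∀ n, τ n ≠ 0)
    (hrec : ∀ n : ℤ, τ (n + 5) * τ n = τ (n + 4) * τ (n + 1) + τ (n + 3) * τ (n + 2)) :
    InvIntegral (fun n => padicValRat p (τ n)) ∨
      ∃ r, InvPole (fun n => padicValRat p (τ n)) r := by
  have hf := somosRatio_ne_zero hne
  have hJ (n : ℤ) := somosInv_eq hne hrec n
  have e1 (n : ℤ) : somosRatio τ (n + 2) = somosInv τ 0 -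
      (somosRatio τ n + (somosRatio τ (n + 1) + (somosRatio τ (n + 1))⁻¹)) := by
    rw [← hJ n, somosInv]; ring
  have e2 (n : ℤ) : somosRatio τ n = somosInv τ 0 -
      (somosRatio τ (n + 2) + (somosRatio τ (n + 1) + (somosRatio τ (n + 1))⁻¹)) := by
    rw [← hJ n, somosInv]; ring
  generalize somosInv τ 0 = J at e1 e2
  have hsum (m : ℤ) (i j : ℤ) (hi : m ≤ padicValRat p (somosRatio τ i)) (hm : m ≤ 0)
      (hj : padicValRat p (somosRatio τ j) = 0) :
      (somosRatio τ i + (somosRatio τ j + (somosRatio τ j)⁻¹)) = 0 ∨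
      m ≤ padicValRat p (somosRatio τ i + (somosRatio τ j + (somosRatio τ j)⁻¹)) :=
    padicValRat_add_ge (.inr hi) (padicValRat_add_ge (.inr (by omega))
      (.inr (by rw [padicValRat.inv]; omega)))
  by_cases hint : J = 0 ∨ 0 ≤ padicValRat p J
  · left
    constructor <;> intro n <;> simp only [← padicValRat_somosRatio hne] <;> intro ha hb
    · have := padicValRat_sub_ge hint (hsum 0 n (n + 1) ha le_rfl hb)
      rw [← e1] at this
      exact this.resolve_left (hf _)
    · have := padicValRat_sub_ge hint (hsum 0 (n + 2) (n + 1) ha le_rfl hb)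
      rw [← e2] at this
      exact this.resolve_left (hf _)
  · push Not at hint
    refine .inr ⟨-padicValRat p J, by omega, ?_, ?_⟩ <;> intro n <;>
      simp only [← padicValRat_somosRatio hne, neg_neg] <;> intro ha hb
    · rw [e1]
      exact padicValRat_sub_eq hint.1 (e1 n ▸ hf _) (hsum _ n (n + 1) ha (by omega) hb)
    · rw [e2]
      exact padicValRat_sub_eq hint.1 (e2 n ▸ hf _) (hsum _ (n + 2) (n + 1) ha (by omega) hb)

theorem padicValRat_nonneg_of_den_eq_one {p : ℕ} {x : ℚ} (hd : x.den = 1) :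
    0 ≤ padicValRat p x := by
  simp [padicValRat, hd]

theorem padicValRat_pos_iff_of_den_eq_one {p : ℕ} [Fact p.Prime] {x : ℚ} (hx : x ≠ 0)
    (hd : x.den = 1) : 0 < padicValRat p x ↔ (p : ℤ) ∣ x.num := by
  have h0 : x.num ≠ 0 := Rat.num_ne_zero.2 hx
  have := padicValInt_dvd_iff (p := p) 1 x.num
  simp only [pow_one, h0, false_or] at this
  rw [this]
  simp only [padicValRat, hd, padicValNat_one_right]
  omega

theorem coprimeWindow_of_isCoprime (p : ℕ) [hp : Fact p.Prime] {τ : ℤ → ℚ} (hne : ∀ n, τ n ≠ 0)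
    (hint : ∀ i : ℤ, 1 ≤ i → i ≤ 5 → (τ i).den = 1)
    (hcop : ∀ i j : ℤ, 1 ≤ i → i < j → j ≤ 5 → IsCoprime (τ i).num (τ j).num) :
    CoprimeWindow (fun n => padicValRat p (τ n)) 1 := by
  have hnn (i : ℤ) (h1 : 1 ≤ i) (h5 : i ≤ 5) : 0 ≤ padicValRat p (τ i) :=
    padicValRat_nonneg_of_den_eq_one (hint i h1 h5)
  have hdvd (i : ℤ) (h1 : 1 ≤ i) (h5 : i ≤ 5) (h : padicValRat p (τ i) ≠ 0) :
      (p : ℤ) ∣ (τ i).num :=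
    (padicValRat_pos_iff_of_den_eq_one (hne i) (hint i h1 h5)).1 (by have := hnn i h1 h5; omega)
  have hu : ¬ IsUnit (p : ℤ) := (Nat.prime_iff_prime_int.1 hp.out).not_isUnit
  by_cases hex : ∃ k : ℤ, 1 ≤ k ∧ k ≤ 5 ∧ padicValRat p (τ k) ≠ 0
  · obtain ⟨k, h1, h5, hk⟩ := hex
    refine ⟨k, h1, h5, hnn k h1 h5, fun i hi1 hi5 hik => ?_⟩
    by_contra hi
    rcases lt_or_gt_of_ne hik with hlt | hlt
    · exact hu ((hcop i k hi1 hlt h5).isUnit_of_dvd' (hdvd i hi1 hi5 hi) (hdvd k h1 h5 hk))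
    · exact hu ((hcop k i h1 hlt hi5).isUnit_of_dvd' (hdvd k h1 h5 hk) (hdvd i hi1 hi5 hi))
  · push Not at hex
    exact ⟨1, le_rfl, by norm_num, hnn 1 (by norm_num) (by norm_num), fun i h1 h5 _ => hex i h1 h5⟩


/-- For a Somos-5 sequence of nonzero rationals whose terms τ₁,…,τ₅ are pairwise
coprime integers, any five consecutive integer terms are pairwise coprime. -/
theorem somos5_coprime (τ : ℤ → ℚ) (hne : ∀ n, τ n ≠ 0)
    (hrec : ∀ n : ℤ, τ (n + 5) * τ n = τ (n + 4) * τ (n + 1) + τ (n + 3) * τ (n + 2))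
    (hint : ∀ i : ℤ, 1 ≤ i → i ≤ 5 → (τ i).den = 1)
    (hcop : ∀ i j : ℤ, 1 ≤ i → i < j → j ≤ 5 → IsCoprime (τ i).num (τ j).num) :
    ∀ i j : ℤ, i ≠ j → |i - j| < 5 →
      (τ i).den = 1 → (τ j).den = 1 → IsCoprime (τ i).num (τ j).num := by
  intro i j hij hlt hi hj
  rw [Int.isCoprime_iff_gcd_eq_one]
  by_contra hg
  obtain ⟨p, hp, hpg⟩ := Nat.exists_prime_and_dvd hg
  have : Fact p.Prime := ⟨hp⟩
  have hpi := (padicValRat_pos_iff_of_den_eq_one (hne i) hi).2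
    ((Int.natCast_dvd_natCast.2 hpg).trans (Int.gcd_dvd_left _ _))
  have hpj := (padicValRat_pos_iff_of_den_eq_one (hne j) hj).2
    ((Int.natCast_dvd_natCast.2 hpg).trans (Int.gcd_dvd_right _ _))
  have hv := isSomosVal_padicValRat (p := p) hne hrec
  have hw := coprimeWindow_of_isCoprime p hne hint hcop
  rw [abs_lt] at hlt
  rcases invIntegral_or_invPole p hne hrec with hI | ⟨r, hJ⟩
  · obtain ⟨k, -, -, -, h0⟩ := hw.all hv hI (min i j)
    have h1 := h0 i (by omega) (by omega)
    have h2 := h0 j (by omega) (by omega)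
    dsimp only at h1 h2
    omega
  · obtain ⟨c, hc⟩ := hw.exists_nonpos hv hJ
    have h1 := hc i
    have h2 := hc j
    omega
end

section
/- For the sequence (Tₙ) = 0,1,-1,1,1,-7,8,-1,-57,391,... satisfying the Somos-5 recurrence, Tₙ ≡ 0 (mod 2) if and only if n ≡ 0 (mod 6), and Tₙ ≡ 0 (mod 3) if and only if n ≡ 0 (mod 8). -/
/-- The `n`-th Somos-4 relation with parity-dependent coefficients. -/
def ParitySomosFour (S : ℕ → ℤ) (n : ℕ) : Prop :=
  S (n + 4) * S n = (if n % 2 = 0 then 1 else 6) * (S (n + 3) * S (n + 1)) - S (n + 2) ^ 2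

lemma ParitySomosFour.add_two {S : ℕ → ℤ} {n : ℕ}
    (hrec : ∀ n, S (n + 5) * S n = S (n + 4) * S (n + 1) + S (n + 3) * S (n + 2))
    (h : ParitySomosFour S n) (h0 : S (n + 1) ≠ 0) : ParitySomosFour S (n + 2) := by
  unfold ParitySomosFour at *
  have e1 := hrec n
  have e2 := hrec (n + 1)
  simp only [Nat.add_mod_right, add_assoc, Nat.reduceAdd] at *
  generalize (if n % 2 = 0 then (1 : ℤ) else 6) = a at *
  apply mul_left_cancel₀ h0
  linear_combination -S (n + 4) * e1 + S (n + 5) * h + S (n + 2) * e2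

lemma paritySomosFour_of_ne_zero {S : ℕ → ℤ}
    (hrec : ∀ n, S (n + 5) * S n = S (n + 4) * S (n + 1) + S (n + 3) * S (n + 2))
    (hz : ParitySomosFour S 0) (ho : ParitySomosFour S 1) {m : ℕ}
    (hne : ∀ k, 0 < k → k < m → S k ≠ 0) (n : ℕ) (hn : n ≤ m) : ParitySomosFour S n := by
  induction n using Nat.strong_induction_on with
  | _ n ih =>
    match n, ih, hn with
    | 0, _, _ => exact hz
    | 1, _, _ => exact ho
    | n + 2, ih, hn =>
      exact (ih n (by omega) (by omega)).add_two hrec (hne _ (by omega) (by omega))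

lemma cast_eq_residue {S : ℕ → ℤ} {m p N : ℕ} (hN : N % 2 = 0) (t : ℕ → ZMod p)
    (hrec : ∀ n, S (n + 5) * S n = S (n + 4) * S (n + 1) + S (n + 3) * S (n + 2))
    (hfour : ∀ n ≤ m, ParitySomosFour S n)
    (hinit : ∀ n < 5, (S n : ZMod p) = t (n % N))
    (ht : ∀ n < N, ∀ x : ZMod p,
      x * t (n % N) = t ((n + 4) % N) * t ((n + 1) % N) + t ((n + 3) % N) * t ((n + 2) % N) →
      x * t ((n + 1) % N) = (if (n + 1) % 2 = 0 then 1 else 6) *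
        (t ((n + 4) % N) * t ((n + 2) % N)) - t ((n + 3) % N) ^ 2 → x = t ((n + 5) % N))
    (hpos : 0 < N) (n : ℕ) (hn : n ≤ m) : (S n : ZMod p) = t (n % N) := by
  induction n using Nat.strong_induction_on with
  | _ n ih =>
    by_cases h5 : n < 5
    · exact hinit n h5
    obtain ⟨k, rfl⟩ : ∃ k, n = k + 5 := ⟨n - 5, by omega⟩
    have i0 := ih k (by omega) (by omega)
    have i1 := ih (k + 1) (by omega) (by omega)
    have i2 := ih (k + 2) (by omega) (by omega)
    have i3 := ih (k + 3) (by omega) (by omega)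
    have i4 := ih (k + 4) (by omega) (by omega)
    have e1 := congrArg (Int.cast : ℤ → ZMod p) (hrec k)
    have e2 := congrArg (Int.cast : ℤ → ZMod p) (hfour (k + 1) (by omega))
    have hk := ht (k % N) (Nat.mod_lt _ hpos) (S (k + 5))
    have hpar : (k % N + 1) % 2 = (k + 1) % 2 := by
      have := Nat.mod_mod_of_dvd k (Nat.dvd_of_mod_eq_zero hN)
      omega
    rw [hpar] at hk
    simp only [Nat.mod_add_mod, Nat.mod_mod] at hk
    push_cast [add_assoc] at e1 e2
    rw [i0, i1, i2, i3, i4] at e1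
    rw [i1, i2, i3, i4] at e2
    exact hk e1 e2

/-- A zero at an even index `m` forces a geometric symmetry about `m / 2`. -/
lemma exists_reflection {S : ℕ → ℤ} {m : ℕ} (hm : 5 ≤ m) (hm2 : m % 2 = 0)
    (h1 : S 1 = 1) (h2 : S 2 = -1) (h3 : S 3 = 1) (h4 : S 4 = 1)
    (hrec : ∀ n, S (n + 5) * S n = S (n + 4) * S (n + 1) + S (n + 3) * S (n + 2))
    (hfour : ∀ n ≤ m, ParitySomosFour S n)
    (hne : ∀ k, 0 < k → k < m → S k ≠ 0) (hzero : S m = 0) :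
    ∃ c b : ℚ, ∀ k, 0 < k → k < m → (S (m - k) : ℚ) = c * b ^ k * S k := by
  obtain ⟨r, rfl⟩ : ∃ r, m = r + 5 := ⟨m - 5, by omega⟩
  have hv1 : (S (r + 4) : ℚ) ≠ 0 := by exact_mod_cast hne _ (by omega) (by omega)
  have hv2 : (S (r + 3) : ℚ) ≠ 0 := by exact_mod_cast hne _ (by omega) (by omega)
  refine ⟨-S (r + 4) ^ 2 / S (r + 3), -S (r + 3) / S (r + 4), ?_⟩
  set b : ℚ := -S (r + 3) / S (r + 4) with hb
  set c : ℚ := -S (r + 4) ^ 2 / S (r + 3) with hc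
  have hb0 : b ≠ 0 := by simp [hb, hv1, hv2]
  have hc0 : c ≠ 0 := by simp [hc, hv1, hv2]
  have e4 := congrArg (Int.cast : ℤ → ℚ) (hfour (r + 1) (by omega))
  have e5 := congrArg (Int.cast : ℤ → ℚ) (hrec r)
  push_cast [add_assoc] at e4 e5
  simp only [hzero, show (r + 1) % 2 = 0 by omega, if_true] at e4 e5
  have w3 : (S (r + 2) : ℚ) = S (r + 3) ^ 2 / S (r + 4) := by
    field_simp
    push_cast at e4
    linear_combination -e4
  have w4 : (S (r + 1) : ℚ) = -S (r + 3) ^ 3 / S (r + 4) ^ 2 := by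
    rw [w3] at e5
    field_simp at e5 ⊢
    push_cast at e5
    linear_combination -e5
  intro k
  induction k using Nat.strong_induction_on with
  | _ k ih =>
    intro hk0 hkm
    match k, ih, hk0, hkm with
    | 1, _, _, _ =>
      rw [h1, hb, hc, show r + 5 - 1 = r + 4 by omega]; push_cast; field_simp
    | 2, _, _, _ =>
      rw [h2, hb, hc, show r + 5 - 2 = r + 3 by omega]; push_cast; field_simp
    | 3, _, _, _ =>
      rw [h3, hb, hc, show r + 5 - 3 = r + 2 by omega, w3]; push_cast; field_simp
    | 4, _, _, _ =>
      rw [h4, hb, hc, show r + 5 - 4 = r + 1 by omega, w4]; push_cast; field_simp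
    | j + 5, ih, _, hkm =>
      have i1 := ih (j + 1) (by omega) (by omega) (by omega)
      have i2 := ih (j + 2) (by omega) (by omega) (by omega)
      have i3 := ih (j + 3) (by omega) (by omega) (by omega)
      have i4 := ih (j + 4) (by omega) (by omega) (by omega)
      obtain ⟨s, rfl⟩ : ∃ s, r = s + j := ⟨r - j, by omega⟩
      rw [show s + j + 5 - (j + 1) = s + 4 by omega] at i1
      rw [show s + j + 5 - (j + 2) = s + 3 by omega] at i2
      rw [show s + j + 5 - (j + 3) = s + 2 by omega] at i3
      rw [show s + j + 5 - (j + 4) = s + 1 by omega] at i4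
      rw [show s + j + 5 - (j + 5) = s by omega]
      have f := congrArg (Int.cast : ℤ → ℚ) (hfour (j + 1) (by omega))
      have g := congrArg (Int.cast : ℤ → ℚ) (hfour s (by omega))
      push_cast [add_assoc] at f g
      simp only [show s % 2 = (j + 1) % 2 by omega] at f g
      generalize (if (j + 1) % 2 = 0 then (1 : ℚ) else 6) = a at f g
      have hj : (S (j + 1) : ℚ) ≠ 0 := by exact_mod_cast hne _ (by omega) (by omega)
      rw [i1, i2, i3, i4] at g
      refine mul_left_cancel₀ (mul_ne_zero (mul_ne_zero hc0 (pow_ne_zero (j + 1) hb0)) hj) ?_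
      linear_combination g - c ^ 2 * b ^ (2 * j + 6) * f

lemma duplication_factor_eq_zero {S : ℕ → ℤ} {l : ℕ} (hl : 3 ≤ l)
    (h1 : S 1 = 1) (h2 : S 2 = -1) (h3 : S 3 = 1) (h4 : S 4 = 1)
    (hrec : ∀ n, S (n + 5) * S n = S (n + 4) * S (n + 1) + S (n + 3) * S (n + 2))
    (hfour : ∀ n ≤ 2 * l, ParitySomosFour S n)
    (hne : ∀ k, 0 < k → k < 2 * l → S k ≠ 0) (hzero : S (2 * l) = 0) :
    S (l - 1) ^ 2 * S (l + 2) = S (l - 2) * S (l + 1) ^ 2 := by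
  obtain ⟨c, b, h⟩ :=
    exists_reflection (by omega) (by omega) h1 h2 h3 h4 hrec hfour hne hzero
  have hmid := h l (by omega) (by omega)
  have e1 := h (l + 1) (by omega) (by omega)
  have e2 := h (l + 2) (by omega) (by omega)
  rw [show 2 * l - l = l by omega] at hmid
  rw [show 2 * l - (l + 1) = l - 1 by omega] at e1
  rw [show 2 * l - (l + 2) = l - 2 by omega] at e2
  have hl0 : (S l : ℚ) ≠ 0 := by exact_mod_cast hne _ (by omega) (by omega)
  have hcb : c * b ^ l = 1 := mul_right_cancel₀ hl0 (by rw [← hmid, one_mul])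
  rw [pow_succ, ← mul_assoc, hcb, one_mul] at e1
  rw [pow_add, ← mul_assoc, hcb, one_mul] at e2
  have : (S (l - 1) : ℚ) ^ 2 * S (l + 2) = S (l - 2) * S (l + 1) ^ 2 := by
    rw [e1, e2]; ring
  exact_mod_cast this

/-- One period of the sequence modulo `2`. -/
def residuesTwo (n : ℕ) : ZMod 2 := [0, 1, 1, 1, 1, 1].getD n 0

/-- One period of the sequence modulo `3`. -/
def residuesThree (n : ℕ) : ZMod 3 := [0, 1, 2, 1, 1, 2, 2, 2, 0, 1, 1, 1, 2, 2, 1, 2].getD n 0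

/-- One period of the sequence modulo `7`. -/
def residuesSeven (n : ℕ) : ZMod 7 :=
  [0, 1, 6, 1, 1, 0, 1, 6, 6, 6, 0, 1, 1, 1, 6, 0, 6, 6, 1, 6].getD n 0

lemma cast_eq_residuesTwo {S : ℕ → ℤ} (h0 : S 0 = 0) (h1 : S 1 = 1) (h2 : S 2 = -1)
    (h3 : S 3 = 1) (h4 : S 4 = 1)
    (hrec : ∀ n, S (n + 5) * S n = S (n + 4) * S (n + 1) + S (n + 3) * S (n + 2))
    {m : ℕ} (hfour : ∀ n ≤ m, ParitySomosFour S n) (n : ℕ) (hn : n ≤ m) :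
    (S n : ZMod 2) = residuesTwo (n % 6) := by
  refine cast_eq_residue (by norm_num) residuesTwo hrec hfour ?_ ?_ (by norm_num) n hn
  · intro n hn
    interval_cases n <;> simp only [h0, h1, h2, h3, h4] <;> decide
  · decide

lemma cast_eq_residuesThree {S : ℕ → ℤ} (h0 : S 0 = 0) (h1 : S 1 = 1) (h2 : S 2 = -1)
    (h3 : S 3 = 1) (h4 : S 4 = 1)
    (hrec : ∀ n, S (n + 5) * S n = S (n + 4) * S (n + 1) + S (n + 3) * S (n + 2))
    {m : ℕ} (hfour : ∀ n ≤ m, ParitySomosFour S n) (n : ℕ) (hn : n ≤ m) :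
    (S n : ZMod 3) = residuesThree (n % 16) := by
  refine cast_eq_residue (by norm_num) residuesThree hrec hfour ?_ ?_ (by norm_num) n hn
  · intro n hn
    interval_cases n <;> simp only [h0, h1, h2, h3, h4] <;> decide
  · decide

lemma cast_eq_residuesSeven {S : ℕ → ℤ} (h0 : S 0 = 0) (h1 : S 1 = 1) (h2 : S 2 = -1)
    (h3 : S 3 = 1) (h4 : S 4 = 1)
    (hrec : ∀ n, S (n + 5) * S n = S (n + 4) * S (n + 1) + S (n + 3) * S (n + 2))
    {m : ℕ} (hfour : ∀ n ≤ m, ParitySomosFour S n) (n : ℕ) (hn : n ≤ m) :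
    (S n : ZMod 7) = residuesSeven (n % 20) := by
  refine cast_eq_residue (by norm_num) residuesSeven hrec hfour ?_ ?_ (by norm_num) n hn
  · intro n hn
    interval_cases n <;> simp only [h0, h1, h2, h3, h4] <;> decide
  · decide

lemma ne_zero_of_pos {S : ℕ → ℤ} (h0 : S 0 = 0) (h1 : S 1 = 1) (h2 : S 2 = -1)
    (h3 : S 3 = 1) (h4 : S 4 = 1) (h5 : S 5 = -7)
    (hrec : ∀ n, S (n + 5) * S n = S (n + 4) * S (n + 1) + S (n + 3) * S (n + 2))
    (m : ℕ) (hm : 0 < m) : S m ≠ 0 := by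
  induction m using Nat.strong_induction_on with
  | _ m ih =>
    intro hzero
    have hne : ∀ k, 0 < k → k < m → S k ≠ 0 := fun k hk hkm => ih k hkm hk
    have hfour := paritySomosFour_of_ne_zero hrec (by simp [ParitySomosFour, *])
      (by simp [ParitySomosFour, *]) hne
    have c2 := cast_eq_residuesTwo h0 h1 h2 h3 h4 hrec hfour m le_rfl
    have c7 := cast_eq_residuesSeven h0 h1 h2 h3 h4 hrec hfour
    have c7m := c7 m le_rfl
    rw [hzero, Int.cast_zero] at c2 c7m
    have hm6 : m % 6 = 0 :=
      (by decide : ∀ r < 6, 0 = residuesTwo r → r = 0) _ (Nat.mod_lt _ (by norm_num)) c2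
    have hm5 : m % 20 % 5 = 0 :=
      (by decide : ∀ r < 20, 0 = residuesSeven r → r % 5 = 0) _ (Nat.mod_lt _ (by norm_num)) c7m
    obtain ⟨l, rfl⟩ : ∃ l, m = 2 * (l + 2) := ⟨m / 2 - 2, by omega⟩
    have hdup := duplication_factor_eq_zero (by omega) h1 h2 h3 h4 hrec hfour hne hzero
    have hmod := congrArg (Int.cast : ℤ → ZMod 7) hdup
    rw [show l + 2 - 1 = l + 1 by omega, show l + 2 - 2 = l by omega] at hmod
    push_cast at hmod
    rw [c7 (l + 1) (by omega), c7 (l + 2 + 2) (by omega), c7 l (by omega),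
      c7 (l + 2 + 1) (by omega)] at hmod
    have key : ∀ r < 20, (r + 2) % 5 = 0 →
        residuesSeven ((r + 1) % 20) ^ 2 * residuesSeven ((r + 4) % 20) ≠
          residuesSeven r * residuesSeven ((r + 3) % 20) ^ 2 := by decide
    refine key (l % 20) (Nat.mod_lt _ (by norm_num)) (by omega) ?_
    simpa only [Nat.mod_add_mod, add_assoc, Nat.reduceAdd] using hmod

lemma emod_two_and_emod_three_of_nat {S : ℕ → ℤ} (h0 : S 0 = 0) (h1 : S 1 = 1) (h2 : S 2 = -1)
    (h3 : S 3 = 1) (h4 : S 4 = 1) (h5 : S 5 = -7)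
    (hrec : ∀ n, S (n + 5) * S n = S (n + 4) * S (n + 1) + S (n + 3) * S (n + 2))
    (n : ℕ) : (S n % 2 = 0 ↔ n % 6 = 0) ∧ (S n % 3 = 0 ↔ n % 8 = 0) := by
  have hfour := paritySomosFour_of_ne_zero (m := n) hrec (by simp [ParitySomosFour, *])
    (by simp [ParitySomosFour, *]) fun k hk _ => ne_zero_of_pos h0 h1 h2 h3 h4 h5 hrec k hk
  have c2 := cast_eq_residuesTwo h0 h1 h2 h3 h4 hrec hfour n le_rfl
  have c3 := cast_eq_residuesThree h0 h1 h2 h3 h4 hrec hfour n le_rfl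
  constructor
  · have hdvd := ZMod.intCast_zmod_eq_zero_iff_dvd (S n) 2
    push_cast at hdvd
    rw [← Int.dvd_iff_emod_eq_zero, ← hdvd, c2]
    exact (by decide : ∀ r < 6, residuesTwo r = 0 ↔ r = 0) _ (Nat.mod_lt _ (by norm_num))
  · have hdvd := ZMod.intCast_zmod_eq_zero_iff_dvd (S n) 3
    push_cast at hdvd
    rw [← Int.dvd_iff_emod_eq_zero, ← hdvd, c3, ← Nat.mod_mod_of_dvd n (by norm_num : 8 ∣ 16)]
    exact (by decide : ∀ r < 16, residuesThree r = 0 ↔ r % 8 = 0) _ (Nat.mod_lt _ (by norm_num))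

/-- For the antisymmetric Somos-5 sequence (Tₙ) = 0,1,-1,1,1,-7,8,-1,-57,391,…,
Tₙ is even iff n ≡ 0 (mod 6), and 3 ∣ Tₙ iff n ≡ 0 (mod 8). -/
theorem somos5_T_mod23 (T : ℤ → ℤ) (hasym : ∀ n : ℤ, T (-n) = -T n)
    (h0 : T 0 = 0) (h1 : T 1 = 1) (h2 : T 2 = -1) (h3 : T 3 = 1) (h4 : T 4 = 1)
    (h5 : T 5 = -7)
    (hrec : ∀ n : ℤ, T (n + 5) * T n = T (n + 4) * T (n + 1) + T (n + 3) * T (n + 2)) :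
    (∀ n : ℤ, T n % 2 = 0 ↔ n % 6 = 0) ∧ (∀ n : ℤ, T n % 3 = 0 ↔ n % 8 = 0) := by
  have hnat := emod_two_and_emod_three_of_nat (S := fun n : ℕ => T n) (by simpa using h0)
    (by simpa using h1) (by simpa using h2) (by simpa using h3) (by simpa using h4)
    (by simpa using h5) (fun n => by simpa using hrec n)
  have hresidues : ∀ n : ℤ, (T n % 2 = 0 ↔ n % 6 = 0) ∧ (T n % 3 = 0 ↔ n % 8 = 0) := by
    intro n
    obtain ⟨k, rfl | rfl⟩ := n.eq_nat_or_neg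
    · have := hnat k
      omega
    · have := hnat k
      have := hasym k
      omega
  exact ⟨fun n => (hresidues n).1, fun n => (hresidues n).2⟩
end
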